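/- Let 𝔤 be a finite-dimensional simple Lie algebra over ℂ. The ℂ-vector space of symmetric invariant bilinear forms on the Takiff algebra T(𝔤), i.e. symmetric bilinear forms B with B([w,u],v) + B(u,[w,v]) = 0 for all w, u, v ∈ T(𝔤), is two-dimensional, spanned by κ_a and κ_b. -/

import Mathlib

/-- The Takiff bracket on `L × L`: `[(x,x'),(y,y')] = ([x,y], [x,y'] + [x',y])`,
i.e. the bracket of the Takiff algebra `𝔤 ⊗ ℂ[ε]/(ε²)`. -/
def takiffBracket {L : Type*} [LieRing L] (u v : L × L) : L × L :=
  (⁅u.1, v.1⁆, ⁅u.1, v.2⁆ + ⁅u.2, v.1⁆)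

/-- The bilinear form `κ_a((x,x'),(y,y')) = κ(x,y)` on the Takiff algebra,
where `κ` is the Killing form of `L`. -/
noncomputable def kappaA (L : Type*) [LieRing L] [LieAlgebra ℂ L] :
    (L × L) →ₗ[ℂ] (L × L) →ₗ[ℂ] ℂ :=
  LinearMap.mk₂ ℂ (fun u v => killingForm ℂ L u.1 v.1)
    (fun _ _ _ => by simp) (fun _ _ _ => by simp)
    (fun _ _ _ => by simp) (fun _ _ _ => by simp)

/-- The bilinear form `κ_b((x,x'),(y,y')) = κ(x,y') + κ(x',y)` on the Takiff algebra. -/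
noncomputable def kappaB (L : Type*) [LieRing L] [LieAlgebra ℂ L] :
    (L × L) →ₗ[ℂ] (L × L) →ₗ[ℂ] ℂ :=
  LinearMap.mk₂ ℂ (fun u v => killingForm ℂ L u.1 v.2 + killingForm ℂ L u.2 v.1)
    (fun _ _ _ => by simp; ring) (fun _ _ _ => by simp; ring)
    (fun _ _ _ => by simp; ring) (fun _ _ _ => by simp; ring)

/-- The space of symmetric invariant bilinear forms on the Takiff algebra `T(𝔤) = L × L`,
i.e. symmetric bilinear forms `B` with `B([w,u],v) + B(u,[w,v]) = 0` for all `w, u, v`. -/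
noncomputable def invSymForms (L : Type*) [LieRing L] [LieAlgebra ℂ L] :
    Submodule ℂ ((L × L) →ₗ[ℂ] (L × L) →ₗ[ℂ] ℂ) where
  carrier := {B | (∀ u v, B u v = B v u) ∧
    ∀ (w u v : L × L),
      B (takiffBracket w u) v + B u (takiffBracket w v) = 0}
  add_mem' := by
    rintro f g ⟨hf1, hf2⟩ ⟨hg1, hg2⟩
    refine ⟨fun u v => ?_, fun w u v => ?_⟩
    · simp only [LinearMap.add_apply, hf1 u v, hg1 u v]
    · simp only [LinearMap.add_apply]
      linear_combination hf2 w u v + hg2 w u v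
  zero_mem' := ⟨fun u v => rfl, fun w u v => by simp⟩
  smul_mem' := by
    rintro c f ⟨hf1, hf2⟩
    refine ⟨fun u v => ?_, fun w u v => ?_⟩
    · simp only [LinearMap.smul_apply, hf1 u v]
    · simp only [LinearMap.smul_apply, smul_eq_mul]
      linear_combination c * hf2 w u v

/-- The Killing form of a Killing Lie algebra induces an isomorphism onto the dual space, so every
bilinear form is the Killing form twisted by an endomorphism. -/
lemma exists_killingForm_comp {K L : Type*} [Field K] [LieRing L] [LieAlgebra K L]
    [FiniteDimensional K L] [LieAlgebra.IsKilling K L] (C : L →ₗ[K] L →ₗ[K] K) :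
    ∃ T : Module.End K L, ∀ x y, C x y = killingForm K L (T x) y := by
  let e := LinearMap.BilinForm.toDual (killingForm K L)
    (LieAlgebra.IsKilling.killingForm_nondegenerate K L)
  refine ⟨e.symm.toLinearMap ∘ₗ C, fun x y => ?_⟩
  have h : e (e.symm (C x)) = C x := e.apply_symm_apply _
  exact (LinearMap.congr_fun h y).symm

lemma killingForm_lie_add {K L : Type*} [Field K] [LieRing L] [LieAlgebra K L] (w u v : L) :
    killingForm K L ⁅w, u⁆ v + killingForm K L u ⁅w, v⁆ = 0 := by
  have h := LieModule.traceForm_lieInvariant K L L w u v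
  rw [h, neg_add_cancel]

/-- An invariant bilinear form on a simple Lie algebra is a multiple of the Killing form. -/
lemma exists_eq_smul_killingForm {K L : Type*} [Field K] [IsAlgClosed K] [CharZero K]
    [LieRing L] [LieAlgebra K L] [FiniteDimensional K L] [LieAlgebra.IsSimple K L]
    (C : L →ₗ[K] L →ₗ[K] K) (hC : ∀ w u v : L, C ⁅w, u⁆ v + C u ⁅w, v⁆ = 0) :
    ∃ c : K, ∀ x y, C x y = c * killingForm K L x y := by
  obtain ⟨T, hT⟩ := exists_killingForm_comp C
  have hTlie (w u : L) : T ⁅w, u⁆ = ⁅w, T u⁆ := by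
    rw [← sub_eq_zero]
    refine (LieAlgebra.IsKilling.killingForm_nondegenerate K L).1 _ fun v => ?_
    have h1 := hC w u v
    rw [hT, hT] at h1
    rw [map_sub, LinearMap.sub_apply]
    linear_combination h1 - killingForm_lie_add (K := K) w (T u) v
  have : Nontrivial L := LieModule.nontrivial_of_isIrreducible K L L
  obtain ⟨c, hc⟩ := Module.End.exists_eigenvalue T
  let I : LieIdeal K L :=
    { T.eigenspace c with
      lie_mem := fun {w u} hu => by
        have hu' : T u = c • u := Module.End.mem_eigenspace_iff.mp hu
        refine Module.End.mem_eigenspace_iff.mpr ?_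
        rw [hTlie, hu', lie_smul] }
  have hI : I = ⊤ := by
    refine (eq_bot_or_eq_top I).resolve_left fun h => hc ?_
    exact congrArg LieSubmodule.toSubmodule h
  refine ⟨c, fun x y => ?_⟩
  have hx : x ∈ I := hI ▸ LieSubmodule.mem_top x
  have hx' : T x = c • x := Module.End.mem_eigenspace_iff.mp hx
  rw [hT, hx', map_smul, LinearMap.smul_apply, smul_eq_mul]

lemma exists_killingForm_lie_ne_zero (K L : Type*) [Field K] [CharZero K]
    [LieRing L] [LieAlgebra K L] [FiniteDimensional K L] [LieAlgebra.IsSimple K L] :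
    ∃ w u v : L, killingForm K L ⁅w, u⁆ v ≠ 0 := by
  by_contra! h
  refine LieAlgebra.IsSimple.non_abelian (R := K) (L := L) ⟨fun w u => ?_⟩
  exact (LieAlgebra.IsKilling.killingForm_nondegenerate K L).1 _ (h w u)

lemma kappaA_mem_invSymForms (L : Type*) [LieRing L] [LieAlgebra ℂ L] :
    kappaA L ∈ invSymForms L := by
  refine ⟨fun u v => ?_, fun w u v => ?_⟩
  · exact LieModule.traceForm_comm ℂ L L u.1 v.1
  · exact killingForm_lie_add w.1 u.1 v.1

lemma kappaB_mem_invSymForms (L : Type*) [LieRing L] [LieAlgebra ℂ L] :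
    kappaB L ∈ invSymForms L := by
  refine ⟨fun u v => ?_, fun w u v => ?_⟩
  · have h1 := LieModule.traceForm_comm ℂ L L u.1 v.2
    have h2 := LieModule.traceForm_comm ℂ L L u.2 v.1
    simp only [kappaB, LinearMap.mk₂_apply]
    linear_combination h1 + h2
  · simp only [kappaB, LinearMap.mk₂_apply, takiffBracket, map_add, LinearMap.add_apply]
    linear_combination killingForm_lie_add (K := ℂ) w.1 u.1 v.2 +
      killingForm_lie_add (K := ℂ) w.1 u.2 v.1 + killingForm_lie_add (K := ℂ) w.2 u.1 v.1

lemma linearIndependent_kappaA_kappaB (L : Type*) [LieRing L] [LieAlgebra ℂ L]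
    [FiniteDimensional ℂ L] [LieAlgebra.IsSimple ℂ L] :
    LinearIndependent ℂ ![kappaA L, kappaB L] := by
  obtain ⟨w, u, y, h⟩ := exists_killingForm_lie_ne_zero ℂ L
  rw [LinearIndependent.pair_iff]
  intro s t hst
  have h1 := LinearMap.congr_fun₂ hst (⁅w, u⁆, 0) (y, 0)
  have h2 := LinearMap.congr_fun₂ hst (⁅w, u⁆, 0) (0, y)
  simp only [kappaA, kappaB, LinearMap.add_apply, LinearMap.smul_apply, LinearMap.mk₂_apply,
    map_zero, LinearMap.zero_apply, add_zero, smul_eq_mul, mul_zero, zero_add, mul_eq_zero,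
    h, or_false] at h1 h2
  exact ⟨h1, h2⟩

/-- An invariant symmetric form on the Takiff algebra is a combination of `κ_a` and `κ_b`. -/
lemma exists_eq_smul_kappaA_add_smul_kappaB {L : Type*} [LieRing L] [LieAlgebra ℂ L]
    [FiniteDimensional ℂ L] [LieAlgebra.IsSimple ℂ L]
    {B : (L × L) →ₗ[ℂ] (L × L) →ₗ[ℂ] ℂ} (hB : B ∈ invSymForms L) :
    ∃ a b : ℂ, a • kappaA L + b • kappaB L = B := by
  obtain ⟨hsymm, hinv⟩ := hB
  let i := LinearMap.inl ℂ L L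
  let j := LinearMap.inr ℂ L L
  obtain ⟨a, ha⟩ := exists_eq_smul_killingForm (B.compl₁₂ i i) fun w u v => by
    simpa [i, takiffBracket] using hinv (w, 0) (u, 0) (v, 0)
  obtain ⟨b, hb⟩ := exists_eq_smul_killingForm (B.compl₁₂ i j) fun w u v => by
    simpa [i, j, takiffBracket] using hinv (w, 0) (u, 0) (0, v)
  obtain ⟨d, hd⟩ := exists_eq_smul_killingForm (B.compl₁₂ j j) fun w u v => by
    simpa [j, takiffBracket] using hinv (w, 0) (0, u) (0, v)
  simp only [LinearMap.compl₁₂_apply, i, j, LinearMap.inl_apply, LinearMap.inr_apply] at ha hb hd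
  have hd0 : d = 0 := by
    obtain ⟨w, u, v, h⟩ := exists_killingForm_lie_ne_zero ℂ L
    have h1 : B (0, ⁅w, u⁆) (0, v) = 0 := by
      have h2 := hinv (0, w) (u, 0) (0, v)
      simp only [takiffBracket, zero_lie, lie_zero, zero_add, add_zero] at h2
      rwa [Prod.mk_zero_zero, map_zero, add_zero] at h2
    rw [hd] at h1
    exact (mul_eq_zero.mp h1).resolve_right h
  refine ⟨a, b, LinearMap.ext₂ fun u v => ?_⟩
  have hsplit (p : L × L) : p = (p.1, 0) + (0, p.2) := by simp
  have hBuv : B u v = B (u.1, 0) (v.1, 0) + B (u.1, 0) (0, v.2) + B (v.1, 0) (0, u.2)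
      + B (0, u.2) (0, v.2) := by
    rw [hsymm (v.1, 0) (0, u.2)]
    conv_lhs => rw [hsplit u, hsplit v]
    simp only [map_add, LinearMap.add_apply]
    ring
  rw [hBuv, ha, hb, hb, hd, hd0]
  have h3 : killingForm ℂ L u.2 v.1 = killingForm ℂ L v.1 u.2 :=
    LieModule.traceForm_comm ℂ L L u.2 v.1
  simp only [kappaA, kappaB, LinearMap.add_apply, LinearMap.smul_apply, LinearMap.mk₂_apply,
    smul_eq_mul, h3]
  ring

/-- For a finite-dimensional simple Lie algebra `L` over `ℂ`, the space of symmetric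
invariant bilinear forms on the Takiff algebra `T(𝔤)` is two-dimensional, spanned by
`κ_a` and `κ_b`. -/
theorem invSymForms_eq_span
    (L : Type*) [LieRing L] [LieAlgebra ℂ L] [FiniteDimensional ℂ L]
    [LieAlgebra.IsSimple ℂ L] :
    Module.finrank ℂ (invSymForms L) = 2 ∧
      invSymForms L = Submodule.span ℂ {kappaA L, kappaB L} := by
  have hspan : invSymForms L = Submodule.span ℂ {kappaA L, kappaB L} := by
    refine le_antisymm (fun B hB => ?_) (Submodule.span_le.mpr ?_)
    · exact Submodule.mem_span_pair.mpr (exists_eq_smul_kappaA_add_smul_kappaB hB)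
    · rintro _ (rfl | rfl)
      · exact kappaA_mem_invSymForms L
      · exact kappaB_mem_invSymForms L
  refine ⟨?_, hspan⟩
  have h := finrank_span_eq_card (linearIndependent_kappaA_kappaB L)
  rwa [Matrix.range_cons_cons_empty, ← hspan, Fintype.card_fin] at h
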